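/- Let Θ : E^s₁ → E^s₂ be an isomorphism of standard Courant algebroids on F*⊕𝒢⊕F, of the form Θ(ξ+r+x) = (ξ + β(x) − 2φ*τ(r)) + (τ(r) + φ(x)) + x. Then the induced map ι : 𝒜^s₁ → 𝒜^s₂, ι(r+x) = (τ(r) + φ(x)) + x, is an isomorphism of the associated ample Lie algebroid structures on 𝒢⊕F, and if C^s₁, C^s₂ denote the standard coherent 3-forms on 𝒜^s₁ and 𝒜^s₂ respectively, then ι*C^s₂ − C^s₁ = d(½Ψ_β + Φ_{τ⁻¹φ}), where Φ_J(r+x,s+y) = ⟨r,J(y)⟩_𝒢 − ⟨s,J(x)⟩_𝒢 for a bundle map J : F → 𝒢 and Ψ_K(r+x,s+y) = ⟨x,K(y)⟩ − ⟨y,K(x)⟩ for a bundle map K : F → F*. -/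

import Mathlib

/-! # Statement 15
An isomorphism `Θ` of standard Courant algebroid structures on `F*⊕𝒢⊕F`, of the
normal form given by `(τ,φ,β)`, induces an isomorphism `ι(r+x) = (τ(r)+φ(x)) + x` of
the ample Lie algebroids `𝒜^s₁ → 𝒜^s₂`, and `ι*C^s₂ − C^s₁ = d(½Ψ_β + Φ_{τ⁻¹φ})`.

Algebraic model: `A` plays the role of `C^∞(M)`, vector fields are
`Derivation ℝ A A`, `F` is a bracket-closed `A`-submodule of `Derivation ℝ A A`. -/

/-- A Courant algebroid (in algebraic form). -/
structure CourantAlgebroid (A : Type) [CommRing A] [Algebra ℝ A]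
    (E : Type) [AddCommGroup E] [Module A E] [Module ℝ E] [IsScalarTower ℝ A E] where
  /-- the pseudo-metric `⟨-,-⟩` -/
  ip : E →ₗ[A] E →ₗ[A] A
  /-- the anchor `ρ` -/
  rho : E →ₗ[A] Derivation ℝ A A
  /-- the Dorfman bracket `∘` (ℝ-bilinear) -/
  dorf : E →ₗ[ℝ] E →ₗ[ℝ] E
  /-- the map `𝒟 : C^∞(M) → Γ(E)` -/
  Dmap : A → E
  ip_symm : ∀ e₁ e₂, ip e₁ e₂ = ip e₂ e₁
  /-- fiberwise nondegeneracy of the pseudo-metric: `Ξ : E → E*` is bijective -/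
  ip_nondeg : Function.Bijective fun e => ip e
  /-- `⟨𝒟f, e⟩ = ½ ρ(e) f` -/
  ip_D : ∀ (f : A) (e : E), (2 : A) * ip (Dmap f) e = rho e f
  /-- `ρ ∘ 𝒟 = 0` -/
  rho_D : ∀ f : A, rho (Dmap f) = 0
  dorf_jacobi : ∀ e₁ e₂ e₃,
    dorf e₁ (dorf e₂ e₃) = dorf (dorf e₁ e₂) e₃ + dorf e₂ (dorf e₁ e₃)
  rho_dorf : ∀ e₁ e₂, rho (dorf e₁ e₂) = ⁅rho e₁, rho e₂⁆
  dorf_leibniz : ∀ (e₁ : E) (f : A) (e₂ : E),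
    dorf e₁ (f • e₂) = rho e₁ f • e₂ + f • dorf e₁ e₂
  dorf_sym : ∀ e₁ e₂, dorf e₁ e₂ + dorf e₂ e₁ = (2 : ℝ) • Dmap (ip e₁ e₂)
  dorf_D : ∀ (f : A) (e : E), dorf (Dmap f) e = 0
  rho_ip : ∀ e₁ e₂ e₃,
    rho e₁ (ip e₂ e₃) = ip (dorf e₁ e₂) e₃ + ip e₂ (dorf e₁ e₃)

namespace CourantAlgebroid

variable {A : Type} [CommRing A] [Algebra ℝ A]
variable {E : Type} [AddCommGroup E] [Module A E] [Module ℝ E] [IsScalarTower ℝ A E]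
variable (ca : CourantAlgebroid A E)

/-- `(ker ρ)⊥`, the subbundle of `E` orthogonal to `ker ρ` w.r.t. the pseudo-metric. -/
def perp : Submodule A E where
  carrier := {e | ∀ k ∈ LinearMap.ker ca.rho, ca.ip e k = 0}
  add_mem' := by
    intro a b ha hb k hk
    simp [map_add, ha k hk, hb k hk]
  zero_mem' := by intro k hk; simp
  smul_mem' := by
    intro c x hx k hk
    simp [map_smul, hx k hk]

/-- Regularity (constant rank of the anchor), expressed by the splitting of the two
canonical short exact sequences `0 → ker ρ → E → F → 0` and
`0 → (ker ρ)⊥ → ker ρ → 𝒢 → 0`. -/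
def IsRegular : Prop :=
  (∃ lam : ↥(LinearMap.range ca.rho) →ₗ[A] E, ∀ x, ca.rho (lam x) = ↑x) ∧
  (∃ sig : (↥(LinearMap.ker ca.rho) ⧸
        (ca.perp.comap (LinearMap.ker ca.rho).subtype)) →ₗ[A] ↥(LinearMap.ker ca.rho),
      ∀ g, (ca.perp.comap (LinearMap.ker ca.rho).subtype).mkQ (sig g) = g)

lemma dorf_mem_ker {r s : E} (hr : r ∈ LinearMap.ker ca.rho)
    (hs : s ∈ LinearMap.ker ca.rho) : ca.dorf r s ∈ LinearMap.ker ca.rho := by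
  rw [LinearMap.mem_ker] at *
  rw [ca.rho_dorf, hr, hs, zero_lie]

lemma dorf_ker_left_mem_ker (e : E) {r : E} (hr : r ∈ LinearMap.ker ca.rho) :
    ca.dorf e r ∈ LinearMap.ker ca.rho := by
  rw [LinearMap.mem_ker] at *
  rw [ca.rho_dorf, hr, lie_zero]

/-- sections of `ker ρ` -/
abbrev Ker := ↥(LinearMap.ker ca.rho)

/-- `(ker ρ)⊥` viewed inside `ker ρ` -/
abbrev perp' : Submodule A ca.Ker := ca.perp.comap (LinearMap.ker ca.rho).subtype

/-- `𝒢 := ker ρ/(ker ρ)⊥` -/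
abbrev Gq := ca.Ker ⧸ ca.perp'

/-- the projection `π : ker ρ → 𝒢` -/
abbrev piG : ca.Ker →ₗ[A] ca.Gq := ca.perp'.mkQ

/-- the ample quotient `𝒜_E := E/(ker ρ)⊥` -/
abbrev Ample := E ⧸ ca.perp

/-- the projection `q : E → 𝒜_E` -/
abbrev qA : E →ₗ[A] ca.Ample := ca.perp.mkQ

/-- Dorfman bracket of two sections of `ker ρ`, viewed in `ker ρ`. -/
def dorfK (r s : ca.Ker) : ca.Ker := ⟨ca.dorf ↑r ↑s, ca.dorf_mem_ker r.2 s.2⟩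

/-- Dorfman bracket of a section of `E` with a section of `ker ρ`, viewed in `ker ρ`. -/
def dorfEK (e : E) (r : ca.Ker) : ca.Ker := ⟨ca.dorf e ↑r, ca.dorf_ker_left_mem_ker e r.2⟩

end CourantAlgebroid

section CE
variable {V A : Type} [CommRing A]

/-- differential of a `1`-form -/
def dCE1 (act : V → A → A) (bk : V → V → V) (ω : V → A) (x₀ x₁ : V) : A :=
  act x₀ (ω x₁) - act x₁ (ω x₀) - ω (bk x₀ x₁)

/-- differential of a `2`-form -/
def dCE2 (act : V → A → A) (bk : V → V → V) (ω : V → V → A) (x₀ x₁ x₂ : V) : A :=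
  act x₀ (ω x₁ x₂) - act x₁ (ω x₀ x₂) + act x₂ (ω x₀ x₁)
    - ω (bk x₀ x₁) x₂ + ω (bk x₀ x₂) x₁ - ω (bk x₁ x₂) x₀

/-- differential of a `3`-form -/
def dCE3 (act : V → A → A) (bk : V → V → V) (ω : V → V → V → A)
    (x₀ x₁ x₂ x₃ : V) : A :=
  act x₀ (ω x₁ x₂ x₃) - act x₁ (ω x₀ x₂ x₃) + act x₂ (ω x₀ x₁ x₃)
    - act x₃ (ω x₀ x₁ x₂)
    - ω (bk x₀ x₁) x₂ x₃ + ω (bk x₀ x₂) x₁ x₃ - ω (bk x₀ x₃) x₁ x₂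
    - ω (bk x₁ x₂) x₀ x₃ + ω (bk x₁ x₃) x₀ x₂ - ω (bk x₂ x₃) x₀ x₁

/-- differential of a `4`-form -/
def dCE4 (act : V → A → A) (bk : V → V → V) (ω : V → V → V → V → A)
    (x₀ x₁ x₂ x₃ x₄ : V) : A :=
  act x₀ (ω x₁ x₂ x₃ x₄) - act x₁ (ω x₀ x₂ x₃ x₄) + act x₂ (ω x₀ x₁ x₃ x₄)
    - act x₃ (ω x₀ x₁ x₂ x₄) + act x₄ (ω x₀ x₁ x₂ x₃)
    - ω (bk x₀ x₁) x₂ x₃ x₄ + ω (bk x₀ x₂) x₁ x₃ x₄ - ω (bk x₀ x₃) x₁ x₂ x₄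
    + ω (bk x₀ x₄) x₁ x₂ x₃
    - ω (bk x₁ x₂) x₀ x₃ x₄ + ω (bk x₁ x₃) x₀ x₂ x₄ - ω (bk x₁ x₄) x₀ x₂ x₃
    - ω (bk x₂ x₃) x₀ x₁ x₄ + ω (bk x₂ x₄) x₀ x₁ x₃
    - ω (bk x₃ x₄) x₀ x₁ x₂

end CE

section StandardCA

variable {A : Type} [CommRing A] [Algebra ℝ A]
variable (F : Submodule A (Derivation ℝ A A))
variable {G : Type} [AddCommGroup G] [Module A G] [Module ℝ G] [IsScalarTower ℝ A G]

/-- the leafwise Lie bracket on the integrable subbundle `F` -/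
def fbk (hF : ∀ x y : ↥F, ⁅(x : Derivation ℝ A A), (y : Derivation ℝ A A)⁆ ∈ F)
    (x y : ↥F) : ↥F :=
  ⟨⁅(x : Derivation ℝ A A), (y : Derivation ℝ A A)⁆, hF x y⟩

/-- the action of vector fields tangent to `F` on functions -/
def fact (x : ↥F) (f : A) : A := (x : Derivation ℝ A A) f

/-- A standard Courant algebroid structure on `F*⊕𝒢⊕F`: the anchor is the projection
onto `F`, the pseudo-metric is `½⟨ξ₁,x₂⟩ + ½⟨ξ₂,x₁⟩ + ⟨r₁,r₂⟩_𝒢`, and the 𝒢-component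
of the Dorfman bracket of sections of 𝒢 is the fiberwise bracket `[-,-]_𝒢`. -/
def IsStandardCA (lG : G → G → G) (ipG : G → G → A)
    (ca : CourantAlgebroid A (Module.Dual A ↥F × G × ↥F)) : Prop :=
  (∀ p, ca.rho p = ↑p.2.2) ∧
  (∀ p q, ca.ip p q =
    (2:ℝ)⁻¹ • p.1 q.2.2 + (2:ℝ)⁻¹ • q.1 p.2.2 + ipG p.2.1 q.2.1) ∧
  (∀ r s : G, (ca.dorf (0, r, 0) (0, s, 0)).2.1 = lG r s)

variable (ca : CourantAlgebroid A (Module.Dual A ↥F × G × ↥F))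

/-- the `F`-connection `∇` on `𝒢` induced by a standard Courant algebroid -/
def sNabla (x : ↥F) (r : G) : G := (ca.dorf (0, 0, x) (0, r, 0)).2.1

/-- the curvature-type bundle map `R : ∧²F → 𝒢` induced by a standard Courant algebroid -/
def sR (x y : ↥F) : G := (ca.dorf (0, 0, x) (0, 0, y)).2.1

/-- the 3-form `ℋ ∈ Γ(∧³F*)` induced by a standard Courant algebroid -/
def sH (x y z : ↥F) : A := (ca.dorf (0, 0, x) (0, 0, y)).1 z

/-- the 4-form `⟨R∧R⟩` on `F` -/
noncomputable def pontR (ipG : G → G → A) (Rm : ↥F → ↥F → G)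
    (x₁ x₂ x₃ x₄ : ↥F) : A :=
  (4:ℝ)⁻¹ • ∑ σ : Equiv.Perm (Fin 4),
    (Equiv.Perm.sign σ : ℤ) •
      ipG (Rm (![x₁, x₂, x₃, x₄] (σ 0)) (![x₁, x₂, x₃, x₄] (σ 1)))
          (Rm (![x₁, x₂, x₃, x₄] (σ 2)) (![x₁, x₂, x₃, x₄] (σ 3)))

end StandardCA

section StandardAmple

variable {A : Type} [CommRing A] [Algebra ℝ A]
variable (F : Submodule A (Derivation ℝ A A))
variable {G : Type} [AddCommGroup G] [Module A G] [Module ℝ G] [IsScalarTower ℝ A G]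

/-- the standard bracket on `𝒜^s = 𝒢⊕F` determined by `(F,𝒢;∇,R)`:
`[r,s] = [r,s]_𝒢`, `[x,y] = R(x,y) + [x,y]`, `[x,r] = ∇_x r` -/
def stdBkt (hF : ∀ x y : ↥F, ⁅(x : Derivation ℝ A A), (y : Derivation ℝ A A)⁆ ∈ F)
    (lG : G → G → G) (Nb : ↥F → G → G) (Rm : ↥F → ↥F → G)
    (p q : G × ↥F) : G × ↥F :=
  (lG p.1 q.1 + Nb p.2 q.1 - Nb q.2 p.1 + Rm p.2 q.2, fbk F hF p.2 q.2)

/-- the anchor of `𝒜^s = 𝒢⊕F` acting on functions -/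
def stdAct (p : G × ↥F) (f : A) : A := (p.2 : Derivation ℝ A A) f

/-- the standard 3-form `C^s` on `𝒜^s = 𝒢⊕F` -/
def stdCs (lG : G → G → G) (ipG : G → G → A) (Rm : ↥F → ↥F → G)
    (Hm : ↥F → ↥F → ↥F → A) (p q w : G × ↥F) : A :=
  Hm p.2 q.2 w.2 - ipG (lG p.1 q.1) w.1
    + ipG (Rm p.2 q.2) w.1 + ipG (Rm q.2 w.2) p.1 + ipG (Rm w.2 p.2) q.1

end StandardAmple

section StandardBracket

variable {A : Type} [CommRing A] [Algebra ℝ A]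
variable {F : Submodule A (Derivation ℝ A A)}
variable {G : Type} [AddCommGroup G] [Module A G] [Module ℝ G] [IsScalarTower ℝ A G]
variable {lG : G → G → G} {ipG : G →ₗ[A] G →ₗ[A] A}
variable {ca : CourantAlgebroid A (Module.Dual A ↥F × G × ↥F)}

lemma sNabla_zero (ca : CourantAlgebroid A (Module.Dual A ↥F × G × ↥F)) (x : ↥F) :
    sNabla F ca x 0 = 0 := by
  have : ((0, 0, 0) : Module.Dual A ↥F × G × ↥F) = 0 := rfl
  simp [sNabla, this]

namespace IsStandardCA

/-- The `F`-component of the Dorfman bracket is the bracket of the `F`-components. -/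
lemma dorf_anchor (h : IsStandardCA F lG (fun r s => ipG r s) ca)
    (hF : ∀ x y : ↥F, ⁅(x : Derivation ℝ A A), (y : Derivation ℝ A A)⁆ ∈ F)
    (p q : Module.Dual A ↥F × G × ↥F) : (ca.dorf p q).2.2 = fbk F hF p.2.2 q.2.2 := by
  apply Subtype.ext
  rw [← h.1, ca.rho_dorf, h.1, h.1]
  rfl

/-- The pseudo-metric of a standard structure, with the denominators cleared. -/
lemma two_mul_ip (h : IsStandardCA F lG (fun r s => ipG r s) ca)
    (p q : Module.Dual A ↥F × G × ↥F) :
    2 * ca.ip p q = p.1 q.2.2 + q.1 p.2.2 + 2 * ipG p.2.1 q.2.1 := by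
  rw [h.2.1]
  simp only [two_mul]
  module

/-- Invariance of the pseudo-metric under the Dorfman bracket, in components. -/
lemma metric_invariance (h : IsStandardCA F lG (fun r s => ipG r s) ca)
    (e p q : Module.Dual A ↥F × G × ↥F) :
    (e.2.2 : Derivation ℝ A A) (p.1 q.2.2 + q.1 p.2.2 + 2 * ipG p.2.1 q.2.1) =
      ((ca.dorf e p).1 q.2.2 + q.1 (ca.dorf e p).2.2 + 2 * ipG (ca.dorf e p).2.1 q.2.1)
      + (p.1 (ca.dorf e q).2.2 + (ca.dorf e q).1 p.2.2 + 2 * ipG p.2.1 (ca.dorf e q).2.1) := by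
  simp only [← h.two_mul_ip]
  have := ca.rho_ip e p q
  rw [h.1] at this
  rw [two_mul, map_add, this]
  ring

/-- The symmetric part of the Dorfman bracket lies in `F*`. -/
lemma dorf_symm_snd_fst (h : IsStandardCA F lG (fun r s => ipG r s) ca)
    (ipG_nondeg : ∀ r, (∀ s, ipG r s = 0) → r = 0)
    (p q : Module.Dual A ↥F × G × ↥F) :
    (ca.dorf p q).2.1 = - (ca.dorf q p).2.1 := by
  have hD : ∀ f : A, (ca.Dmap f).2.1 = 0 := by
    intro f
    apply ipG_nondeg
    intro s
    have h1 := ca.ip_D f (0, s, 0)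
    have h2 : (ca.Dmap f).2.2 = 0 := by
      apply Subtype.ext
      rw [← h.1, ca.rho_D]
      rfl
    rw [h.two_mul_ip, h.1] at h1
    simp only [map_zero, zero_add, h2, ZeroMemClass.coe_zero,
      Derivation.coe_zero, Pi.zero_apply] at h1
    have h3 : (2⁻¹ : ℝ) • (2 * ipG (ca.Dmap f).2.1 s) = 0 := by rw [h1, smul_zero]
    rw [← h3, two_mul]
    module
  have := congrArg (fun e => e.2.1) (ca.dorf_sym p q)
  simp only [Prod.snd_add, Prod.fst_add, Prod.smul_snd, Prod.smul_fst, hD, smul_zero] at this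
  exact eq_neg_of_add_eq_zero_left this

/-- The symmetric part of the Dorfman bracket is the differential of the pseudo-metric. -/
lemma dorf_symm_fst (h : IsStandardCA F lG (fun r s => ipG r s) ca)
    (p q : Module.Dual A ↥F × G × ↥F) (y : ↥F) :
    (ca.dorf p q).1 y + (ca.dorf q p).1 y =
      (y : Derivation ℝ A A) (p.1 q.2.2 + q.1 p.2.2 + 2 * ipG p.2.1 q.2.1) := by
  have hD : ∀ f : A, (ca.Dmap f).1 y = (y : Derivation ℝ A A) f := by
    intro f
    have h1 := ca.ip_D f (0, 0, y)
    rw [h.two_mul_ip, h.1] at h1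
    simpa using h1
  have := congrArg (fun e => e.1 y) (ca.dorf_sym p q)
  simp only [Prod.fst_add, Prod.smul_fst, LinearMap.add_apply, LinearMap.smul_apply, hD] at this
  rw [this, ← h.two_mul_ip, two_mul, map_add, two_smul]

/-- Bracketing with a section of `F*` has no `𝒢`-component. -/
lemma dorf_dual_snd_fst (h : IsStandardCA F lG (fun r s => ipG r s) ca)
    (ipG_nondeg : ∀ r, (∀ s, ipG r s = 0) → r = 0)
    (e : Module.Dual A ↥F × G × ↥F) (ξ : Module.Dual A ↥F) :
    (ca.dorf e (ξ, 0, 0)).2.1 = 0 := by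
  apply ipG_nondeg
  intro s
  have h1 := h.metric_invariance e (ξ, 0, 0) (0, s, 0)
  have h2 : (ca.dorf e (0, s, 0)).2.2 = 0 := by
    apply Subtype.ext
    rw [← h.1, ca.rho_dorf, h.1, h.1]
    simp
  simp only [h2, map_zero, LinearMap.zero_apply, mul_zero, add_zero, zero_add] at h1
  have h3 : (2⁻¹ : ℝ) • (2 * ipG (ca.dorf e (ξ, 0, 0)).2.1 s) = 0 := by rw [← h1, smul_zero]
  rw [← h3, two_mul]
  module

/-- The `𝒢`-component of the Dorfman bracket of a standard structure. -/
lemma dorf_snd_fst (h : IsStandardCA F lG (fun r s => ipG r s) ca)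
    (ipG_nondeg : ∀ r, (∀ s, ipG r s = 0) → r = 0)
    (ξ η : Module.Dual A ↥F) (r s : G) (x y : ↥F) :
    (ca.dorf (ξ, r, x) (η, s, y)).2.1 =
      lG r s + sNabla F ca x s - sNabla F ca y r + sR F ca x y := by
  have hd : ∀ (ξ : Module.Dual A ↥F) (r : G) (x : ↥F),
      ((ξ, r, x) : Module.Dual A ↥F × G × ↥F) = (ξ, 0, 0) + ((0, r, 0) + (0, 0, x)) := by
    intro ξ r x; simp
  have h0 := h.dorf_symm_snd_fst ipG_nondeg (ξ, 0, 0)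
  rw [hd ξ r x, hd η s y]
  simp only [map_add, LinearMap.add_apply, Prod.snd_add, Prod.fst_add,
    h.dorf_dual_snd_fst ipG_nondeg, h0, h.2.2, neg_zero, zero_add,
    h.dorf_symm_snd_fst ipG_nondeg (0, r, 0) (0, 0, y), sNabla, sR]
  abel

/-- The curvature of a standard structure is skew-symmetric. -/
lemma sR_skew (h : IsStandardCA F lG (fun r s => ipG r s) ca)
    (ipG_nondeg : ∀ r, (∀ s, ipG r s = 0) → r = 0) (x y : ↥F) :
    sR F ca x y = - sR F ca y x :=
  h.dorf_symm_snd_fst ipG_nondeg _ _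

/-- The induced connection preserves the metric of `𝒢`. -/
lemma sNabla_metric (h : IsStandardCA F lG (fun r s => ipG r s) ca) (x : ↥F) (r s : G) :
    (x : Derivation ℝ A A) (ipG r s) =
      ipG (sNabla F ca x r) s + ipG r (sNabla F ca x s) := by
  have h1 := ca.rho_ip (0, 0, x) (0, r, 0) (0, s, 0)
  have h2 : ∀ s : G, (ca.dorf (0, 0, x) (0, s, 0)).2.2 = 0 := by
    intro s
    apply Subtype.ext
    rw [← h.1, ca.rho_dorf, h.1, h.1]
    simp
  rw [h.1, h.2.1, h.2.1, h.2.1] at h1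
  simpa [h2, sNabla] using h1

/-- The `3`-form `ℋ` is skew-symmetric in its first two arguments. -/
lemma sH_skew₁₂ (h : IsStandardCA F lG (fun r s => ipG r s) ca) (x y z : ↥F) :
    sH F ca x y z = - sH F ca y x z := by
  have := h.dorf_symm_fst (0, 0, x) (0, 0, y) z
  simp only [map_zero, LinearMap.zero_apply, mul_zero, add_zero] at this
  exact eq_neg_of_add_eq_zero_left this

/-- The `3`-form `ℋ` is skew-symmetric in its last two arguments. -/
lemma sH_skew₂₃ (h : IsStandardCA F lG (fun r s => ipG r s) ca) (x y z : ↥F) :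
    sH F ca x y z = - sH F ca x z y := by
  have := h.metric_invariance (0, 0, x) (0, 0, y) (0, 0, z)
  simp only [map_zero, LinearMap.zero_apply, mul_zero, add_zero, zero_add] at this
  exact eq_neg_of_add_eq_zero_left this.symm

/-- The `F*`-component of the Dorfman bracket of a standard structure. -/
lemma dorf_fst (h : IsStandardCA F lG (fun r s => ipG r s) ca)
    (hF : ∀ x y : ↥F, ⁅(x : Derivation ℝ A A), (y : Derivation ℝ A A)⁆ ∈ F)
    (lG_zero : ∀ r, lG r 0 = 0)
    (ipG_nondeg : ∀ r, (∀ s, ipG r s = 0) → r = 0)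
    (ξ η : Module.Dual A ↥F) (r s : G) (x y z : ↥F) :
    (ca.dorf (ξ, r, x) (η, s, y)).1 z =
      sH F ca x y z + (x : Derivation ℝ A A) (η z) - η (fbk F hF x z)
      - (y : Derivation ℝ A A) (ξ z) + ξ (fbk F hF y z) + (z : Derivation ℝ A A) (ξ y)
      + 2 * ipG s (sNabla F ca z r) - 2 * ipG s (sR F ca x z) + 2 * ipG r (sR F ca y z) := by
  have e1 := h.metric_invariance (ξ, r, x) (η, s, y) (0, 0, z)
  have e2 := h.dorf_symm_fst (ξ, r, x) (0, 0, z) y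
  have e3 := h.metric_invariance (0, 0, z) (ξ, r, x) (0, 0, y)
  have e4 : (ca.dorf (0, 0, z) (0, 0, y)).1 x = sH F ca x y z * (-1) := by
    change sH F ca z y x = _
    rw [h.sH_skew₂₃ z y x, h.sH_skew₁₂ z x y, h.sH_skew₂₃ x z y]
    ring
  have e5 : fbk F hF z y = - fbk F hF y z := Subtype.ext (lie_skew _ _).symm
  simp only [h.dorf_anchor hF, h.dorf_snd_fst ipG_nondeg, LinearMap.zero_apply, map_zero,
    mul_zero, add_zero, sNabla_zero, lG_zero, map_add, map_neg, map_sub, e4, e5,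
    h.sR_skew ipG_nondeg z y, zero_sub] at e1 e2 e3
  linear_combination - e1 - e2 - e3

end IsStandardCA

end StandardBracket

open CourantAlgebroid in
/-- The induced map `ι` on the ample Lie algebroids is an isomorphism
of Lie algebroids, and the standard coherent 3-forms satisfy
`ι*C^s₂ − C^s₁ = d(½Ψ_β + Φ_{τ⁻¹φ})`. -/
theorem statement15
    {A : Type} [CommRing A] [Algebra ℝ A]
    (F : Submodule A (Derivation ℝ A A))
    (hF : ∀ x y : ↥F, ⁅(x : Derivation ℝ A A), (y : Derivation ℝ A A)⁆ ∈ F)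
    {G : Type} [AddCommGroup G] [Module A G] [Module ℝ G] [IsScalarTower ℝ A G]
    -- 𝒢 is a bundle of quadratic Lie algebras
    (lG : G →ₗ[A] G →ₗ[A] G) (ipG : G →ₗ[A] G →ₗ[A] A)
    (lG_skew : ∀ r s, lG r s = - lG s r)
    (lG_jacobi : ∀ r s t, lG r (lG s t) = lG (lG r s) t + lG s (lG r t))
    (ipG_symm : ∀ r s, ipG r s = ipG s r)
    (ipG_nondeg : ∀ r, (∀ s, ipG r s = 0) → r = 0)
    (ipG_ad : ∀ r s t, ipG (lG r s) t + ipG s (lG r t) = 0)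
    -- two standard Courant algebroid structures E^s₁, E^s₂ on F*⊕𝒢⊕F
    (ca₁ ca₂ : CourantAlgebroid A (Module.Dual A ↥F × G × ↥F))
    (hstd₁ : IsStandardCA F (fun r s => lG r s) (fun r s => ipG r s) ca₁)
    (hstd₂ : IsStandardCA F (fun r s => lG r s) (fun r s => ipG r s) ca₂)
    -- an isomorphism of Courant algebroids Θ : E^s₁ → E^s₂ ...
    (Θ : (Module.Dual A ↥F × G × ↥F) ≃ₗ[A] (Module.Dual A ↥F × G × ↥F))
    (hΘ_rho : ∀ p, ca₂.rho (Θ p) = ca₁.rho p)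
    (hΘ_ip : ∀ p q, ca₂.ip (Θ p) (Θ q) = ca₁.ip p q)
    (hΘ_dorf : ∀ p q, Θ (ca₁.dorf p q) = ca₂.dorf (Θ p) (Θ q))
    -- ... of the normal form Θ(ξ+r+x) = (ξ + β(x) − 2φ*τ(r)) + (τ(r) + φ(x)) + x
    (τ : G ≃ₗ[A] G) (φm : ↥F →ₗ[A] G) (β : ↥F →ₗ[A] Module.Dual A ↥F)
    (hτ_l : ∀ r s, τ (lG r s) = lG (τ r) (τ s))
    (hτ_ip : ∀ r s, ipG (τ r) (τ s) = ipG r s)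
    (hβ : ∀ x y : ↥F, (2:ℝ)⁻¹ • β x y + (2:ℝ)⁻¹ • β y x + ipG (φm x) (φm y) = 0)
    (hform₁ : ∀ p, (Θ p).2.2 = p.2.2)
    (hform₂ : ∀ p, (Θ p).2.1 = τ p.2.1 + φm p.2.2)
    (hform₃ : ∀ p (y : ↥F), (Θ p).1 y = p.1 y + β p.2.2 y - 2 * ipG (τ p.2.1) (φm y)) :
    -- ι(r+x) = (τ(r) + φ(x)) + x is an isomorphism of the ample Lie algebroids
    -- 𝒜^s₁ → 𝒜^s₂ over the identity ...
    (Function.Bijective fun p : G × ↥F => ((τ p.1 + φm p.2, p.2) : G × ↥F)) ∧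
    (∀ p q : G × ↥F,
      ((fun p : G × ↥F => ((τ p.1 + φm p.2, p.2) : G × ↥F))
          (stdBkt F hF (fun r s => lG r s) (sNabla F ca₁) (sR F ca₁) p q))
        = stdBkt F hF (fun r s => lG r s) (sNabla F ca₂) (sR F ca₂)
            ((τ p.1 + φm p.2, p.2)) ((τ q.1 + φm q.2, q.2))) ∧
    -- ... and ι*C^s₂ − C^s₁ = d(½Ψ_β + Φ_{τ⁻¹φ})
    (∀ p q w : G × ↥F,
      stdCs F (fun r s => lG r s) (fun r s => ipG r s) (sR F ca₂) (sH F ca₂)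
          ((τ p.1 + φm p.2, p.2)) ((τ q.1 + φm q.2, q.2)) ((τ w.1 + φm w.2, w.2))
        - stdCs F (fun r s => lG r s) (fun r s => ipG r s) (sR F ca₁) (sH F ca₁) p q w
      = dCE2 (stdAct F) (stdBkt F hF (fun r s => lG r s) (sNabla F ca₁) (sR F ca₁))
          (fun p q =>
            (2:ℝ)⁻¹ • (β q.2 p.2 - β p.2 q.2)
              + (ipG p.1 (τ.symm (φm q.2)) - ipG q.1 (τ.symm (φm p.2))))
          p q w) := by
  have hΘ : ∀ p, Θ p = (p.1 + β p.2.2 - (2 : A) • (ipG (τ p.2.1)).comp φm,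
      τ p.2.1 + φm p.2.2, p.2.2) := by
    intro p
    refine Prod.ext (LinearMap.ext fun y => ?_) (Prod.ext (hform₂ p) (hform₁ p))
    simp [hform₃]
  have hbkt : ∀ p q : G × ↥F,
      τ (stdBkt F hF (fun r s => lG r s) (sNabla F ca₁) (sR F ca₁) p q).1 + φm (fbk F hF p.2 q.2) =
        (stdBkt F hF (fun r s => lG r s) (sNabla F ca₂) (sR F ca₂)
            ((τ p.1 + φm p.2, p.2)) ((τ q.1 + φm q.2, q.2))).1 := by
    rintro ⟨r, x⟩ ⟨s, y⟩
    have := congrArg (fun e => e.2.1) (hΘ_dorf (0, r, x) (0, s, y))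
    simp only [hstd₁.dorf_snd_fst ipG_nondeg, hstd₁.dorf_anchor hF, hΘ,
      hstd₂.dorf_snd_fst ipG_nondeg] at this
    exact this
  have hR₁ : ∀ x y, τ (sR F ca₁ x y) = lG (φm x) (φm y) + sNabla F ca₂ x (φm y)
      - sNabla F ca₂ y (φm x) + sR F ca₂ x y - φm (fbk F hF x y) := fun x y => by
    have := hbkt (0, x) (0, y)
    simp only [stdBkt, map_zero, zero_add, sNabla_zero, sub_zero] at this
    exact eq_sub_of_add_eq this
  have hτN : ∀ x r, τ (sNabla F ca₁ x r) = lG (φm x) (τ r) + sNabla F ca₂ x (τ r) := fun x r => by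
    have := congrArg (fun e => e.2.1) (hΘ_dorf (0, 0, x) (0, r, 0))
    have hb : fbk F hF x 0 = 0 := Subtype.ext (lie_zero _)
    simp only [hΘ, hstd₁.dorf_snd_fst ipG_nondeg, hstd₁.dorf_anchor hF,
      hstd₂.dorf_snd_fst ipG_nondeg, hb, map_zero, add_zero, zero_add, sNabla_zero, sub_zero, LinearMap.zero_apply,
      map_add] at this
    have h0 := hR₁ x 0
    simp only [hb, map_zero, sNabla_zero, add_zero, sub_zero, zero_sub] at h0
    rw [← eq_sub_iff_add_eq, h0] at this
    rw [this]
    abel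
  have hβ' : ∀ x y, β x y + β y x = - (2 * ipG (φm x) (φm y)) := fun x y => by
    have := congrArg (fun a => (2 : ℝ) • a) (hβ x y)
    simp only [smul_add, smul_zero, smul_inv_smul₀ (two_ne_zero' ℝ)] at this
    rw [two_smul] at this
    linear_combination this
  have hω : ∀ p q : G × ↥F, (2:ℝ)⁻¹ • (β q.2 p.2 - β p.2 q.2)
        + (ipG p.1 (τ.symm (φm q.2)) - ipG q.1 (τ.symm (φm p.2))) =
      β q.2 p.2 + ipG (φm p.2) (φm q.2) + ipG (τ p.1) (φm q.2) - ipG (τ q.1) (φm p.2) := by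
    intro p q
    have h1 : β q.2 p.2 - β p.2 q.2 = (2 : ℝ) • (β q.2 p.2 + ipG (φm p.2) (φm q.2)) := by
      rw [two_smul]
      linear_combination - hβ' p.2 q.2
    rw [h1, inv_smul_smul₀ (two_ne_zero' ℝ), ← hτ_ip p.1, ← hτ_ip q.1, τ.apply_symm_apply,
      τ.apply_symm_apply]
    ring
  have hH : ∀ x y z, sH F ca₁ x y z + β (fbk F hF x y) z - 2 * ipG (τ (sR F ca₁ x y)) (φm z) =
      sH F ca₂ x y z + (x : Derivation ℝ A A) (β y z) - β y (fbk F hF x z)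
      - (y : Derivation ℝ A A) (β x z) + β x (fbk F hF y z) + (z : Derivation ℝ A A) (β x y)
      + 2 * ipG (φm y) (sNabla F ca₂ z (φm x)) - 2 * ipG (φm y) (sR F ca₂ x z)
      + 2 * ipG (φm x) (sR F ca₂ y z) := fun x y z => by
    have := congrArg (fun e => e.1 z) (hΘ_dorf (0, 0, x) (0, 0, y))
    simp only [hform₃, hstd₁.dorf_snd_fst ipG_nondeg, hstd₁.dorf_anchor hF, map_zero, sNabla_zero] at this
    simp only [hΘ, hstd₂.dorf_fst hF (fun r => map_zero (lG r)) ipG_nondeg, map_zero,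
      LinearMap.zero_comp, smul_zero, sub_zero, zero_add] at this
    exact this
  refine ⟨⟨?_, ?_⟩, fun p q => Prod.ext (hbkt p q) rfl, ?_⟩
  · rintro ⟨r, x⟩ ⟨s, y⟩ h
    obtain ⟨h1, rfl⟩ := Prod.mk.inj h
    exact congrArg (·, x) (τ.injective (add_right_cancel h1))
  · rintro ⟨r, x⟩
    exact ⟨(τ.symm (r - φm x), x), by simp⟩
  · rintro ⟨r, x⟩ ⟨s, y⟩ ⟨t, z⟩
    have hτ_ip' : ∀ x y r, ipG (sR F ca₁ x y) r = ipG (τ (sR F ca₁ x y)) (τ r) :=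
      fun x y r => (hτ_ip _ _).symm
    have hlip : ∀ r s t, ipG (lG r s) t = ipG (lG (τ r) (τ s)) (τ t) := fun r s t => by
      rw [← hτ_l, hτ_ip]
    have hfs : ∀ x y, fbk F hF x y = - fbk F hF y x := fun x y => Subtype.ext (lie_skew _ _).symm
    have hm := hstd₂.sNabla_metric
    have cyc : ∀ a b c, ipG (lG a b) c = ipG (lG b c) a := fun a b c => by
      have := ipG_ad b a c
      rw [lG_skew b a, map_neg, LinearMap.neg_apply, ipG_symm a] at this
      linear_combination - this
    have sk : ∀ a b c, ipG (lG a b) c = - ipG (lG b a) c := fun a b c => by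
      rw [lG_skew a b, map_neg, LinearMap.neg_apply]
    have dβ : ∀ x y z : ↥F, (x : Derivation ℝ A A) (β y z) + (x : Derivation ℝ A A) (β z y) =
        - (2 * (ipG (sNabla F ca₂ x (φm y)) (φm z) + ipG (sNabla F ca₂ x (φm z)) (φm y))) :=
      fun x y z => by
        rw [← map_add, hβ', ipG_symm _ (φm y), ← hm, two_mul, map_neg, map_add, two_mul]
    have H := hH x y z
    simp only [hω]
    simp only [dCE2, stdAct, stdCs, stdBkt, hτ_ip', hlip r s t, hτ_l, hτN, hR₁, map_add, map_sub,
      LinearMap.add_apply, LinearMap.sub_apply, hm] at H ⊢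
    simp only [ipG_symm _ (sNabla F ca₂ _ _), ipG_symm _ (sR F ca₂ _ _),
      ipG_symm _ (φm (fbk F hF _ _)), hstd₂.sR_skew ipG_nondeg z x, hfs z x, map_neg,
      LinearMap.neg_apply] at H ⊢
    linear_combination - H - dβ x y z + dβ y x z - dβ z x y + hβ' (fbk F hF x y) z
      - cyc (φm x) (τ s) (τ t) - sk (τ r) (φm y) (τ t) + cyc (φm y) (τ r) (τ t)
      - cyc (φm x) (φm y) (τ t) - sk (φm x) (φm y) (τ t) + cyc (φm y) (φm x) (τ t)
      - sk (τ r) (φm y) (φm z) - cyc (φm y) (φm z) (τ r)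
      - sk (φm z) (φm x) (τ s) + cyc (φm x) (φm z) (τ s)
      - cyc (φm x) (φm y) (φm z) - sk (φm x) (φm y) (φm z) + cyc (φm y) (φm x) (φm z)
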